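/- Two-sided eigenvalue asymptotics for periodic Hill's equation: let ϱ be continuous on [0,2π] with ϱ₀ := inf ϱ > 0 and ϱ₁ := (1/π)∫₀^{2π} ϱ(ξ)dξ. For l ≥ 1, let μ_l^± denote the eigenvalues of −φ'' + ϱφ = μφ with periodic boundary conditions on [0,2π] whose eigenfunctions have exactly 2l zeros in [0,2π). Then l² + ϱ₀ ≤ μ_l^± ≤ l² + ϱ₁. -/

import Mathlib

open Set Filter Topology Real

/-- The derivative of the scaled Prüfer angle `arctan (k φ / φ')`. -/
noncomputable def pruferRate (φ : ℝ → ℝ) (k x : ℝ) : ℝ :=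
  k * (deriv φ x ^ 2 - φ x * deriv (deriv φ) x) / (deriv φ x ^ 2 + k ^ 2 * φ x ^ 2)

/-- A branch of the scaled Prüfer angle away from the zeros of `φ`. -/
noncomputable def pruferAngle (φ : ℝ → ℝ) (k x : ℝ) : ℝ :=
  -arctan (deriv φ x / (k * φ x))

theorem ContDiff.contDiff_one_deriv {φ : ℝ → ℝ} (hφ : ContDiff ℝ 2 φ) :
    ContDiff ℝ 1 (deriv φ) := by
  have h : ContDiff ℝ (1 + 1) φ := by simpa [one_add_one_eq_two] using hφ
  exact (contDiff_succ_iff_deriv.1 h).2.2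

theorem ContDiff.hasDerivAt_of_two {φ : ℝ → ℝ} (hφ : ContDiff ℝ 2 φ) (x : ℝ) :
    HasDerivAt φ (deriv φ x) x :=
  (hφ.differentiable (by norm_num) x).hasDerivAt

theorem ContDiff.hasDerivAt_deriv_of_two {φ : ℝ → ℝ} (hφ : ContDiff ℝ 2 φ) (x : ℝ) :
    HasDerivAt (deriv φ) (deriv (deriv φ) x) x :=
  (hφ.contDiff_one_deriv.differentiable (by norm_num) x).hasDerivAt

theorem ContDiff.continuous_deriv_deriv_of_two {φ : ℝ → ℝ} (hφ : ContDiff ℝ 2 φ) :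
    Continuous (deriv (deriv φ)) :=
  hφ.contDiff_one_deriv.continuous_deriv le_rfl

/-- Points at which `φ` and `φ'` do not both vanish have a positive Prüfer radius. -/
theorem prufer_radius_pos {u v k : ℝ} (hk : 0 < k) (h : u = 0 → v ≠ 0) :
    0 < v ^ 2 + k ^ 2 * u ^ 2 := by
  by_cases hu : u = 0
  · have := h hu
    positivity
  · positivity

theorem continuousOn_pruferRate {φ : ℝ → ℝ} (hφ : ContDiff ℝ 2 φ) {k : ℝ} (hk : 0 < k)
    {s : Set ℝ} (hnd : ∀ x ∈ s, φ x = 0 → deriv φ x ≠ 0) :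
    ContinuousOn (pruferRate φ k) s := by
  have h0 := hφ.continuous
  have h1 := hφ.contDiff_one_deriv.continuous
  have h2 := hφ.continuous_deriv_deriv_of_two
  refine ContinuousOn.div (by fun_prop) (by fun_prop) fun x hx => ?_
  exact (prufer_radius_pos hk (hnd x hx)).ne'

theorem hasDerivAt_pruferAngle {φ : ℝ → ℝ} (hφ : ContDiff ℝ 2 φ) {k x : ℝ} (hk : 0 < k)
    (hx : φ x ≠ 0) : HasDerivAt (pruferAngle φ k) (pruferRate φ k x) x := by
  have hd := ((hφ.hasDerivAt_deriv_of_two x).div ((hφ.hasDerivAt_of_two x).const_mul k)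
    (mul_ne_zero hk.ne' hx)).arctan.neg
  refine hd.congr_deriv ?_
  have h1 : deriv φ x ^ 2 + k ^ 2 * φ x ^ 2 ≠ 0 := by positivity
  have h2 : 1 + (deriv φ x / (k * φ x)) ^ 2 ≠ 0 := by positivity
  rw [pruferRate]
  simp only [Pi.div_apply]
  have h3 : 1 + (deriv φ x / (k * φ x)) ^ 2
      = (deriv φ x ^ 2 + k ^ 2 * φ x ^ 2) / (k * φ x) ^ 2 := by
    field_simp
    ring
  rw [h3]
  field_simp
  ring

theorem tendsto_deriv_div_slope {φ : ℝ → ℝ} (hφ : ContDiff ℝ 2 φ) {k a : ℝ} (hk : 0 < k)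
    (ha' : deriv φ a ≠ 0) :
    Tendsto (fun x => deriv φ x / (k * slope φ a x)) (𝓝[≠] a) (𝓝 k⁻¹) := by
  have h1 := (hφ.contDiff_one_deriv.continuous.tendsto a).mono_left
    (nhdsWithin_le_nhds (s := {a}ᶜ))
  have h2 := (hasDerivAt_iff_tendsto_slope.1 (hφ.hasDerivAt_of_two a)).const_mul k
  have h3 : deriv φ a / (k * deriv φ a) = k⁻¹ := by field_simp
  exact h3 ▸ h1.div h2 (mul_ne_zero hk.ne' ha')

theorem deriv_div_eq_mul_inv_sub {φ : ℝ → ℝ} {k a x : ℝ} (ha : φ a = 0) (hx : x ≠ a) :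
    deriv φ x / (k * slope φ a x) * (x - a)⁻¹ = deriv φ x / (k * φ x) := by
  have : x - a ≠ 0 := sub_ne_zero.2 hx
  rw [slope_def_field, ha, sub_zero]
  field_simp

theorem tendsto_pruferAngle_right {φ : ℝ → ℝ} (hφ : ContDiff ℝ 2 φ) {k a : ℝ} (hk : 0 < k)
    (ha : φ a = 0) (ha' : deriv φ a ≠ 0) :
    Tendsto (pruferAngle φ k) (𝓝[>] a) (𝓝 (-(π / 2))) := by
  have h1 := (tendsto_deriv_div_slope hφ hk ha').mono_left
    (nhdsWithin_mono a fun x (hx : a < x) => (ne_of_gt hx : x ≠ a))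
  have h2 : Tendsto (fun x => (x - a)⁻¹) (𝓝[>] a) atTop := by
    refine tendsto_inv_nhdsGT_zero.comp (tendsto_nhdsWithin_iff.2 ⟨?_, ?_⟩)
    · exact ((continuous_sub_right a).tendsto' a 0 (sub_self a)).mono_left nhdsWithin_le_nhds
    · filter_upwards [self_mem_nhdsWithin] with x hx using sub_pos.2 (mem_Ioi.1 hx)
  have h3 := h1.pos_mul_atTop (inv_pos.2 hk) h2
  have h4 : Tendsto (fun x => deriv φ x / (k * φ x)) (𝓝[>] a) atTop := by
    refine h3.congr' ?_
    filter_upwards [self_mem_nhdsWithin] with x hx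
    exact deriv_div_eq_mul_inv_sub ha (ne_of_gt hx)
  exact ((tendsto_arctan_atTop.mono_right nhdsWithin_le_nhds).comp h4).neg

theorem tendsto_pruferAngle_left {φ : ℝ → ℝ} (hφ : ContDiff ℝ 2 φ) {k a : ℝ} (hk : 0 < k)
    (ha : φ a = 0) (ha' : deriv φ a ≠ 0) :
    Tendsto (pruferAngle φ k) (𝓝[<] a) (𝓝 (π / 2)) := by
  have h1 := (tendsto_deriv_div_slope hφ hk ha').mono_left
    (nhdsWithin_mono a fun x (hx : x < a) => (ne_of_lt hx : x ≠ a))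
  have h2 : Tendsto (fun x => (x - a)⁻¹) (𝓝[<] a) atBot := by
    refine tendsto_inv_nhdsLT_zero.comp (tendsto_nhdsWithin_iff.2 ⟨?_, ?_⟩)
    · exact ((continuous_sub_right a).tendsto' a 0 (sub_self a)).mono_left nhdsWithin_le_nhds
    · filter_upwards [self_mem_nhdsWithin] with x hx using sub_neg.2 (mem_Iio.1 hx)
  have h3 := h1.pos_mul_atBot (inv_pos.2 hk) h2
  have h4 : Tendsto (fun x => deriv φ x / (k * φ x)) (𝓝[<] a) atBot := by
    refine h3.congr' ?_
    filter_upwards [self_mem_nhdsWithin] with x hx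
    exact deriv_div_eq_mul_inv_sub ha (ne_of_lt hx)
  have h5 := ((tendsto_arctan_atBot.mono_right nhdsWithin_le_nhds).comp h4).neg
  rwa [neg_neg] at h5

theorem intervalIntegrable_pruferRate {φ : ℝ → ℝ} (hφ : ContDiff ℝ 2 φ) {k a b c d : ℝ}
    (hk : 0 < k) (hnd : ∀ x ∈ Icc a b, φ x = 0 → deriv φ x ≠ 0)
    (hac : a ≤ c) (hcd : c ≤ d) (hdb : d ≤ b) :
    IntervalIntegrable (pruferRate φ k) MeasureTheory.volume c d :=
  ContinuousOn.intervalIntegrable_of_Icc hcd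
    (continuousOn_pruferRate hφ hk fun x hx => hnd x ⟨hac.trans hx.1, hx.2.trans hdb⟩)

/-- Over an interval without interior zeros of `φ` the Prüfer angle increases by the difference
of its one-sided limits. -/
theorem integral_pruferRate_of_tendsto {φ : ℝ → ℝ} (hφ : ContDiff ℝ 2 φ) {k a b α β : ℝ}
    (hk : 0 < k) (hab : a < b) (hnd : ∀ x ∈ Icc a b, φ x = 0 → deriv φ x ≠ 0)
    (hne : ∀ x ∈ Ioo a b, φ x ≠ 0)
    (hα : Tendsto (pruferAngle φ k) (𝓝[>] a) (𝓝 α))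
    (hβ : Tendsto (pruferAngle φ k) (𝓝[<] b) (𝓝 β)) :
    ∫ x in a..b, pruferRate φ k x = β - α :=
  intervalIntegral.integral_eq_sub_of_hasDerivAt_of_tendsto hab
    (fun x hx => hasDerivAt_pruferAngle hφ hk (hne x hx))
    (intervalIntegrable_pruferRate hφ hk hnd le_rfl hab.le le_rfl) hα hβ

theorem integral_pruferRate_between_zeros {φ : ℝ → ℝ} (hφ : ContDiff ℝ 2 φ) {k : ℝ} (hk : 0 < k)
    {a : ℝ} (ha : φ a = 0) (n : ℕ) :
    ∀ b, a ≤ b → φ b = 0 → (∀ x ∈ Icc a b, φ x = 0 → deriv φ x ≠ 0) →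
      {x | x ∈ Ico a b ∧ φ x = 0}.Finite → {x | x ∈ Ico a b ∧ φ x = 0}.ncard = n →
      ∫ x in a..b, pruferRate φ k x = n * π := by
  induction n with
  | zero =>
    intro b hab hb hnd hfin hcard
    rcases hab.eq_or_lt with rfl | hlt
    · simp
    · have hmem : a ∈ {x | x ∈ Ico a b ∧ φ x = 0} := ⟨⟨le_rfl, hlt⟩, ha⟩
      rw [(ncard_eq_zero hfin).1 hcard] at hmem
      exact hmem.elim
  | succ n ih =>
    intro b hab hb hnd hfin hcard
    obtain ⟨m, ⟨⟨ham, hmb⟩, hm⟩, hmax⟩ :=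
      hfin.exists_maximal (nonempty_of_ncard_ne_zero (by omega))
    have hle : ∀ x ∈ Ico a b, φ x = 0 → x ≤ m := fun x hx h0 => by
      by_contra! hlt
      exact absurd (hmax ⟨hx, h0⟩ hlt.le) (not_le.2 hlt)
    have hset : {x | x ∈ Ico a m ∧ φ x = 0} = {x | x ∈ Ico a b ∧ φ x = 0} \ {m} := by
      ext x
      simp only [mem_ofPred_eq, mem_Ico, Set.mem_sdiff, mem_singleton_iff]
      constructor
      · rintro ⟨⟨h1, h2⟩, h3⟩
        exact ⟨⟨⟨h1, h2.trans hmb⟩, h3⟩, h2.ne⟩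
      · rintro ⟨⟨⟨h1, h2⟩, h3⟩, h4⟩
        exact ⟨⟨h1, lt_of_le_of_ne (hle x ⟨h1, h2⟩ h3) h4⟩, h3⟩
    have hcard' : {x | x ∈ Ico a m ∧ φ x = 0}.ncard = n := by
      rw [hset, ncard_sdiff_singleton_of_mem (show m ∈ {x | x ∈ Ico a b ∧ φ x = 0} from
        ⟨⟨ham, hmb⟩, hm⟩), hcard, Nat.add_sub_cancel]
    have hleft := ih m ham hm (fun x hx => hnd x ⟨hx.1, hx.2.trans hmb.le⟩)
      (hset ▸ hfin.subset sdiff_subset) hcard'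
    have hright := integral_pruferRate_of_tendsto hφ hk hmb
      (fun x hx => hnd x ⟨ham.trans hx.1, hx.2⟩)
      (fun x hx h0 => absurd (hle x ⟨ham.trans hx.1.le, hx.2⟩ h0) (not_le.2 hx.1))
      (tendsto_pruferAngle_right hφ hk hm (hnd m ⟨ham, hmb.le⟩ hm))
      (tendsto_pruferAngle_left hφ hk hb (hnd b ⟨hab, le_rfl⟩ hb))
    rw [← intervalIntegral.integral_add_adjacent_intervals
      (intervalIntegrable_pruferRate hφ hk hnd le_rfl ham hmb.le)
      (intervalIntegrable_pruferRate hφ hk hnd ham hmb.le le_rfl), hleft, hright]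
    push_cast
    ring

/-- Over a period, the Prüfer angle increases by `π` times the number of zeros. -/
theorem integral_pruferRate_of_periodic {φ : ℝ → ℝ} (hφ : ContDiff ℝ 2 φ) {k a b : ℝ}
    (hk : 0 < k) (hab : a < b) (hnd : ∀ x ∈ Icc a b, φ x = 0 → deriv φ x ≠ 0)
    (h0 : φ a = φ b) (h1 : deriv φ a = deriv φ b) {n : ℕ} (hn : n ≠ 0)
    (hcard : {x | x ∈ Ico a b ∧ φ x = 0}.ncard = n) :
    ∫ x in a..b, pruferRate φ k x = n * π := by
  have hfin : {x | x ∈ Ico a b ∧ φ x = 0}.Finite := finite_of_ncard_ne_zero (by omega)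
  by_cases ha : φ a = 0
  · exact integral_pruferRate_between_zeros hφ hk ha n b hab.le (h0 ▸ ha) hnd hfin hcard
  have hnonempty := nonempty_of_ncard_ne_zero (hcard.trans_ne hn)
  obtain ⟨p, ⟨⟨hap, hpb⟩, hp⟩, hmin⟩ := hfin.exists_minimal hnonempty
  obtain ⟨q, ⟨⟨haq, hqb⟩, hq⟩, hmax⟩ := hfin.exists_maximal hnonempty
  have hpx : ∀ x ∈ Ico a b, φ x = 0 → p ≤ x := fun x hx h0 => by
    by_contra! hlt
    exact absurd (hmin ⟨hx, h0⟩ hlt.le) (not_le.2 hlt)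
  have hxq : ∀ x ∈ Ico a b, φ x = 0 → x ≤ q := fun x hx h0 => by
    by_contra! hlt
    exact absurd (hmax ⟨hx, h0⟩ hlt.le) (not_le.2 hlt)
  have hpq : p ≤ q := hxq p ⟨hap, hpb⟩ hp
  have hap' : a < p := lt_of_le_of_ne hap fun h => ha (h ▸ hp)
  have hset : {x | x ∈ Ico p q ∧ φ x = 0} = {x | x ∈ Ico a b ∧ φ x = 0} \ {q} := by
    ext x
    simp only [mem_ofPred_eq, mem_Ico, Set.mem_sdiff, mem_singleton_iff]
    constructor
    · rintro ⟨⟨h1, h2⟩, h3⟩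
      exact ⟨⟨⟨hap.trans h1, h2.trans hqb⟩, h3⟩, h2.ne⟩
    · rintro ⟨⟨h12, h3⟩, h4⟩
      exact ⟨⟨hpx x h12 h3, lt_of_le_of_ne (hxq x h12 h3) h4⟩, h3⟩
  have hcard' : {x | x ∈ Ico p q ∧ φ x = 0}.ncard = n - 1 := by
    rw [hset, ncard_sdiff_singleton_of_mem (show q ∈ {x | x ∈ Ico a b ∧ φ x = 0} from
      ⟨⟨haq, hqb⟩, hq⟩), hcard]
  have hmid := integral_pruferRate_between_zeros hφ hk hp (n - 1) q hpq hq
    (fun x hx => hnd x ⟨hap.trans hx.1, hx.2.trans hqb.le⟩)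
    (hset ▸ hfin.subset sdiff_subset) hcard'
  have hleft := integral_pruferRate_of_tendsto hφ hk hap'
    (fun x hx => hnd x ⟨hx.1, hx.2.trans hpb.le⟩)
    (fun x hx h => absurd (hpx x ⟨hx.1.le, hx.2.trans hpb⟩ h) (not_le.2 hx.2))
    ((hasDerivAt_pruferAngle hφ hk ha).continuousAt.tendsto.mono_left nhdsWithin_le_nhds)
    (tendsto_pruferAngle_left hφ hk hp (hnd p ⟨hap, hpb.le⟩ hp))
  have hright := integral_pruferRate_of_tendsto hφ hk hqb
    (fun x hx => hnd x ⟨haq.trans hx.1, hx.2⟩)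
    (fun x hx h => absurd (hxq x ⟨haq.trans hx.1.le, hx.2⟩ h) (not_le.2 hx.1))
    (tendsto_pruferAngle_right hφ hk hq (hnd q ⟨haq, hqb.le⟩ hq))
    ((hasDerivAt_pruferAngle hφ hk (h0 ▸ ha)).continuousAt.tendsto.mono_left nhdsWithin_le_nhds)
  have hangle : pruferAngle φ k b = pruferAngle φ k a := by simp only [pruferAngle, h0, h1]
  rw [← intervalIntegral.integral_add_adjacent_intervals
      (intervalIntegrable_pruferRate hφ hk hnd le_rfl hap hpb.le)
      (intervalIntegrable_pruferRate hφ hk hnd hap hpb.le le_rfl),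
    ← intervalIntegral.integral_add_adjacent_intervals
      (intervalIntegrable_pruferRate hφ hk hnd hap hpq hqb.le)
      (intervalIntegrable_pruferRate hφ hk hnd haq hqb.le le_rfl), hleft, hmid, hright, hangle,
    Nat.cast_sub (Nat.one_le_iff_ne_zero.2 hn)]
  push_cast
  ring

/-- A solution of `φ'' + q φ = 0` with vanishing Cauchy data at a point vanishes identically. -/
theorem eq_zero_of_cauchy_data_eq_zero {φ q : ℝ → ℝ} {a b : ℝ} (hφ : ContDiff ℝ 2 φ)
    (hq : ContinuousOn q (Icc a b))
    (heq : ∀ x ∈ Icc a b, deriv (deriv φ) x + q x * φ x = 0) {c : ℝ} (hc : c ∈ Icc a b)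
    (h0 : φ c = 0) (h1 : deriv φ c = 0) {x : ℝ} (hx : x ∈ Icc a b) : φ x = 0 := by
  obtain ⟨M, hM⟩ := isCompact_Icc.exists_bound_of_continuousOn hq
  have hE : ∀ x, HasDerivAt (fun y => φ y ^ 2 + deriv φ y ^ 2)
      (2 * φ x * deriv φ x + 2 * deriv φ x * deriv (deriv φ) x) x := fun x => by
    have := ((hφ.hasDerivAt_of_two x).pow 2).add ((hφ.hasDerivAt_deriv_of_two x).pow 2)
    refine this.congr_deriv ?_
    norm_num
  have hEC : ∀ C x : ℝ, HasDerivAt (fun y => (φ y ^ 2 + deriv φ y ^ 2) * exp (C * y))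
      ((2 * φ x * deriv φ x + 2 * deriv φ x * deriv (deriv φ) x
        + C * (φ x ^ 2 + deriv φ x ^ 2)) * exp (C * x)) x := fun C x => by
    have := (hE x).mul (((hasDerivAt_id x).const_mul C).exp)
    refine this.congr_deriv ?_
    simp only [id]
    ring
  have hbound : ∀ x ∈ Icc a b, |2 * φ x * deriv φ x + 2 * deriv φ x * deriv (deriv φ) x|
      ≤ (1 + M) * (φ x ^ 2 + deriv φ x ^ 2) := fun x hx => by
    have hqx : |1 - q x| ≤ 1 + M := by
      have := hM x hx
      rw [norm_eq_abs, abs_le] at this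
      rw [abs_le]
      constructor <;> linarith
    have hrw : 2 * φ x * deriv φ x + 2 * deriv φ x * deriv (deriv φ) x
        = (1 - q x) * (2 * φ x * deriv φ x) := by
      linear_combination 2 * deriv φ x * heq x hx
    rw [hrw, abs_mul]
    refine mul_le_mul hqx ?_ (abs_nonneg _) ((abs_nonneg _).trans hqx)
    rw [abs_le]
    constructor <;> nlinarith [sq_nonneg (φ x + deriv φ x), sq_nonneg (φ x - deriv φ x)]
  have hcont : ∀ C : ℝ, Continuous fun y => (φ y ^ 2 + deriv φ y ^ 2) * exp (C * y) := fun C =>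
    continuous_iff_continuousAt.2 fun x => (hEC C x).continuousAt
  have hE0 : φ x ^ 2 + deriv φ x ^ 2 ≤ 0 := by
    rcases le_total c x with hcx | hxc
    · have hanti : AntitoneOn (fun y => (φ y ^ 2 + deriv φ y ^ 2) * exp (-(1 + M) * y))
          (Icc a b) := by
        refine antitoneOn_of_deriv_nonpos (convex_Icc a b) (hcont _).continuousOn
          (fun y _ => (hEC _ y).differentiableAt.differentiableWithinAt) fun y hy => ?_
        rw [(hEC _ y).deriv]
        refine mul_nonpos_of_nonpos_of_nonneg ?_ (exp_pos _).le
        linarith [(abs_le.1 (hbound y (interior_subset hy))).2]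
      have := hanti hc hx hcx
      simp only [h0, h1] at this
      by_contra! hpos
      have := mul_pos hpos (exp_pos (-(1 + M) * x))
      linarith
    · have hmono : MonotoneOn (fun y => (φ y ^ 2 + deriv φ y ^ 2) * exp ((1 + M) * y))
          (Icc a b) := by
        refine monotoneOn_of_deriv_nonneg (convex_Icc a b) (hcont _).continuousOn
          (fun y _ => (hEC _ y).differentiableAt.differentiableWithinAt) fun y hy => ?_
        rw [(hEC _ y).deriv]
        refine mul_nonneg ?_ (exp_pos _).le
        linarith [(abs_le.1 (hbound y (interior_subset hy))).1]
      have := hmono hx hc hxc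
      simp only [h0, h1] at this
      by_contra! hpos
      have := mul_pos hpos (exp_pos ((1 + M) * x))
      linarith
  nlinarith [sq_nonneg (deriv φ x), sq_nonneg (φ x)]

/-- Two-sided eigenvalue asymptotics for periodic Hill's equation: if `ϱ` is continuous
on `[0,2π]` with `ϱ₀ = inf ϱ > 0` and `ϱ₁ = (1/π)∫₀^{2π} ϱ`, and `μ` is an eigenvalue of
`−φ'' + ϱφ = μφ` with periodic boundary conditions whose (nonzero) eigenfunction has
exactly `2l` zeros in `[0,2π)` (`l ≥ 1`), then `l² + ϱ₀ ≤ μ ≤ l² + ϱ₁`. -/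
theorem stmt5 (ϱ : ℝ → ℝ) (ϱ₀ ϱ₁ : ℝ)
    (hϱcont : ContinuousOn ϱ (Set.Icc 0 (2 * Real.pi)))
    (hϱ₀def : ϱ₀ = sInf (ϱ '' Set.Icc 0 (2 * Real.pi)))
    (hϱ₀pos : 0 < ϱ₀)
    (hϱ₁def : ϱ₁ = (1 / Real.pi) * ∫ ξ in (0 : ℝ)..(2 * Real.pi), ϱ ξ)
    (l : ℕ) (hl : 1 ≤ l)
    (μ : ℝ) (φ : ℝ → ℝ) (hφ : ContDiff ℝ 2 φ)
    (heq : ∀ ξ ∈ Set.Icc (0 : ℝ) (2 * Real.pi),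
      deriv (deriv φ) ξ + (μ - ϱ ξ) * φ ξ = 0)
    (hbc1 : φ 0 = φ (2 * Real.pi))
    (hbc2 : deriv φ 0 = deriv φ (2 * Real.pi))
    (hne : ∃ ξ ∈ Set.Icc (0 : ℝ) (2 * Real.pi), φ ξ ≠ 0)
    (hzeros : Set.ncard {ξ : ℝ | ξ ∈ Set.Ico (0 : ℝ) (2 * Real.pi) ∧ φ ξ = 0} = 2 * l) :
    (l : ℝ) ^ 2 + ϱ₀ ≤ μ ∧ μ ≤ (l : ℝ) ^ 2 + ϱ₁ := by
  have hpi : (0 : ℝ) < 2 * π := by positivity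
  have hlpos : (0 : ℝ) < l := by exact_mod_cast hl
  have hnd : ∀ x ∈ Icc 0 (2 * π), φ x = 0 → deriv φ x ≠ 0 := fun x hx h0 h1 => by
    obtain ⟨ξ, hξ, hξ0⟩ := hne
    exact hξ0 (eq_zero_of_cauchy_data_eq_zero hφ (continuousOn_const.sub hϱcont) heq hx h0 h1 hξ)
  have hwind : ∀ k : ℝ, 0 < k → ∫ x in (0 : ℝ)..(2 * π), pruferRate φ k x = l * (2 * π) :=
    fun k hk => by
      rw [integral_pruferRate_of_periodic hφ hk hpi hnd hbc1 hbc2 (by omega) hzeros]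
      push_cast
      ring
  have hϱ₀le : ∀ x ∈ Icc 0 (2 * π), ϱ₀ ≤ ϱ x := fun x hx => by
    rw [hϱ₀def]
    exact csInf_le (isCompact_Icc.image_of_continuousOn hϱcont).bddBelow (mem_image_of_mem ϱ hx)
  have hrate : ∀ k, ∀ x ∈ Icc 0 (2 * π), pruferRate φ k x
      = k * (deriv φ x ^ 2 + (μ - ϱ x) * φ x ^ 2) / (deriv φ x ^ 2 + k ^ 2 * φ x ^ 2) :=
    fun k x hx => by
      rw [pruferRate]
      congr 2
      linear_combination -φ x * heq x hx
  have hlower : (l : ℝ) ^ 2 + ϱ₀ ≤ μ := by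
    by_contra! hlt
    have hrate_le : ∀ x ∈ Icc 0 (2 * π), pruferRate φ l x ≤ l := fun x hx => by
      rw [hrate l x hx, div_le_iff₀ (prufer_radius_pos hlpos (hnd x hx))]
      have : (μ - ϱ x) * φ x ^ 2 ≤ (l : ℝ) ^ 2 * φ x ^ 2 :=
        mul_le_mul_of_nonneg_right (by linarith [hϱ₀le x hx]) (sq_nonneg _)
      exact mul_le_mul_of_nonneg_left (by linarith) hlpos.le
    have hrate_lt : ∃ x ∈ Icc 0 (2 * π), pruferRate φ l x < l := by
      obtain ⟨x, hx, hx0⟩ := hne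
      refine ⟨x, hx, ?_⟩
      rw [hrate l x hx, div_lt_iff₀ (prufer_radius_pos hlpos (hnd x hx))]
      have : (μ - ϱ x) * φ x ^ 2 < (l : ℝ) ^ 2 * φ x ^ 2 :=
        mul_lt_mul_of_pos_right (by linarith [hϱ₀le x hx]) (by positivity)
      exact mul_lt_mul_of_pos_left (by linarith) hlpos
    have hint := intervalIntegral.integral_lt_integral_of_continuousOn_of_le_of_exists_lt hpi
      (continuousOn_pruferRate hφ hlpos hnd) continuousOn_const
      (fun x hx => hrate_le x (Ioc_subset_Icc_self hx)) hrate_lt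
    rw [hwind l hlpos, intervalIntegral.integral_const, smul_eq_mul] at hint
    linarith
  refine ⟨hlower, ?_⟩
  have hμ : 0 < μ := by nlinarith
  obtain ⟨s, hs, rfl⟩ : ∃ s : ℝ, 0 < s ∧ μ = s ^ 2 :=
    ⟨√μ, sqrt_pos.2 hμ, (sq_sqrt hμ.le).symm⟩
  have hϱint : IntervalIntegrable ϱ MeasureTheory.volume 0 (2 * π) :=
    hϱcont.intervalIntegrable_of_Icc hpi.le
  have hint : ∫ x in (0 : ℝ)..(2 * π), (s - s⁻¹ * ϱ x)
      ≤ ∫ x in (0 : ℝ)..(2 * π), pruferRate φ s x := by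
    refine intervalIntegral.integral_mono_on hpi.le
      (intervalIntegrable_const.sub (hϱint.const_mul _))
      (intervalIntegrable_pruferRate hφ hs hnd le_rfl hpi.le le_rfl) fun x hx => ?_
    rw [hrate s x hx, le_div_iff₀ (prufer_radius_pos hs (hnd x hx))]
    have h1 : 0 ≤ s⁻¹ * ϱ x * deriv φ x ^ 2 :=
      mul_nonneg (mul_nonneg (inv_pos.2 hs).le (hϱ₀pos.le.trans (hϱ₀le x hx))) (sq_nonneg _)
    have h2 : s⁻¹ * s = 1 := inv_mul_cancel₀ hs.ne'
    have h3 : (s - s⁻¹ * ϱ x) * (deriv φ x ^ 2 + s ^ 2 * φ x ^ 2)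
        = s * (deriv φ x ^ 2 + (s ^ 2 - ϱ x) * φ x ^ 2) - s⁻¹ * ϱ x * deriv φ x ^ 2 := by
      linear_combination -ϱ x * s * φ x ^ 2 * h2
    linarith
  rw [hwind s hs, intervalIntegral.integral_sub intervalIntegrable_const (hϱint.const_mul _),
    intervalIntegral.integral_const, intervalIntegral.integral_const_mul, smul_eq_mul] at hint
  have hI : ∫ ξ in (0 : ℝ)..(2 * π), ϱ ξ = π * ϱ₁ := by
    rw [hϱ₁def]
    field_simp
  rw [hI] at hint
  have hkey : 2 * s * (s - l) ≤ ϱ₁ := by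
    have h1 : π * (2 * s * (s - l)) ≤ π * ϱ₁ := by
      have h2 := mul_le_mul_of_nonneg_left hint hs.le
      have h3 : s * s⁻¹ = 1 := mul_inv_cancel₀ hs.ne'
      have h4 : s * ((2 * π - 0) * s - s⁻¹ * (π * ϱ₁)) = 2 * π * s ^ 2 - π * ϱ₁ := by
        linear_combination -(π * ϱ₁) * h3
      linarith
    exact le_of_mul_le_mul_left h1 pi_pos
  nlinarith [sq_nonneg (s - l)]
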